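/- Let V be a nonempty finite set and let (·,·) be a negative definite symmetric ℤ-valued bilinear form on L := ℤ^V with standard basis {E_v}_{v∈V}, with (E_u,E_v) ∈ {0,1} for all u ≠ v; let the dual graph G (edge between u ≠ v iff (E_u,E_v) = 1) be a tree; let Z_K ∈ ℚ^V be the unique vector with (Z_K,E_v) = (E_v,E_v)+2 for all v, and χ(x) := −(x, x−Z_K)/2. Fix l' with (l',E_v) a nonnegative integer for every v, and a cycle Z ∈ L with all coordinates ≥ 1. If every vertex of the E*-support I := {v ∈ V : (l',E_v) > 0} is an end vertex of G (a vertex of degree ≤ 1), then t(Z,l') = T(Z,l'). -/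

import Mathlib

open Classical

noncomputable section

/-- The rational pairing on `ℚ^V` determined by the integral matrix `M`. -/
def pairQ {V : Type} [Fintype V] (M : Matrix V V ℤ) (x y : V → ℚ) : ℚ :=
  ∑ u, ∑ v, x u * (M u v : ℚ) * y v

/-- The Riemann–Roch expression `χ(x) = −(x, x − Z_K)/2`. -/
def chiQ {V : Type} [Fintype V] (M : Matrix V V ℤ) (ZK : V → ℚ) (x : V → ℚ) : ℚ :=
  - pairQ M x (x - ZK) / 2

/-- Inclusion of integral cycles into `ℚ^V`. -/
def toQ {V : Type} (l : V → ℤ) : V → ℚ := fun v => (l v : ℚ)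

/-- The dual graph: `u ~ v` iff `u ≠ v` and `M u v > 0` (for symmetric `M`). -/
def dualGraph {V : Type} (M : Matrix V V ℤ) : SimpleGraph V :=
  SimpleGraph.fromRel (fun u v => 0 < M u v)

/-- The support `|Z|` of a cycle. -/
def supp {V : Type} (Z : V → ℤ) : Set V := {v | Z v ≠ 0}

/-- The dual graph induced on the support of a cycle. -/
def inducedOnSupp {V : Type} (M : Matrix V V ℤ) (Z : V → ℤ) :
    SimpleGraph (supp Z) :=
  (dualGraph M).induce (supp Z)

/-- The part `Z_c` of a cycle `Z` corresponding to a connected component `c`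
of the dual graph induced on the support of `Z`:  it agrees with `Z` on the
component and vanishes elsewhere. -/
def compCycle {V : Type} (M : Matrix V V ℤ) (Z : V → ℤ)
    (c : (inducedOnSupp M Z).ConnectedComponent) : V → ℤ := fun v =>
  if h : Z v ≠ 0 then
    (if (inducedOnSupp M Z).connectedComponentMk ⟨v, h⟩ = c then Z v else 0)
  else 0

/-- The sum `Σ_i F(Z_i)` of a quantity `F` over the connected components
`Z = Σ_i Z_i` of a cycle. -/
def sumComp {V : Type} [Fintype V] (M : Matrix V V ℤ)
    (F : (V → ℤ) → ℚ) (Z : V → ℤ) : ℚ :=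
  ∑ᶠ c : (inducedOnSupp M Z).ConnectedComponent, F (compCycle M Z c)

end

/-- A forest on a nonempty vertex set has fewer edges than vertices. -/
theorem SimpleGraph.IsAcyclic.card_edgeFinset_lt {V : Type*} [Fintype V] [Nonempty V]
    {G : SimpleGraph V} [Fintype G.edgeSet] (hG : G.IsAcyclic) :
    G.edgeFinset.card + 1 ≤ Fintype.card V := by
  obtain ⟨F, hGF, -, hF, hr⟩ :=
    SimpleGraph.exists_isAcyclic_reachable_eq_le_of_le_of_isAcyclic (le_top : G ≤ ⊤) hG
  have hT : F.IsTree :=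
    ⟨⟨fun u v => hr ▸ SimpleGraph.connected_top.preconnected u v⟩, hF⟩
  rw [← hT.card_edgeFinset]
  gcongr

/-- Counting ordered adjacent pairs inside a nonempty vertex set of a forest. -/
theorem SimpleGraph.IsAcyclic.sum_card_adj_add_two_le {V : Type*} [Fintype V]
    {G : SimpleGraph V} (hG : G.IsAcyclic) {S : Finset V} (hS : S.Nonempty) :
    (∑ u ∈ S, ∑ v ∈ S, if G.Adj u v then 1 else 0) + 2 ≤ 2 * S.card := by
  have : Nonempty (S : Set V) := hS.to_subtype
  have h := (hG.induce (S : Set V)).card_edgeFinset_lt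
  have h2 := (G.induce (S : Set V)).sum_degrees_eq_twice_card_edges
  have h3 : ∑ v, (G.induce (S : Set V)).degree v
      = ∑ u ∈ S, ∑ v ∈ S, if G.Adj u v then 1 else 0 := by
    rw [← Finset.sum_coe_sort S]
    refine Finset.sum_congr rfl fun u _ => ?_
    rw [← Finset.sum_coe_sort S, ← SimpleGraph.card_neighborFinset_eq_degree,
      SimpleGraph.neighborFinset_eq_filter, Finset.card_filter]
    rfl
  have h4 : Fintype.card (S : Set V) = S.card := by simp
  omega

/-- Counting ordered adjacent pairs of a tree after removing a set of end vertices. -/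
theorem SimpleGraph.IsTree.two_mul_card_compl_le {V : Type*} [Fintype V] [DecidableEq V]
    {G : SimpleGraph V} (hG : G.IsTree) {R : Finset V}
    (hR : ∀ v ∈ R, (G.neighborSet v).Subsingleton) :
    2 * Rᶜ.card ≤ (∑ u ∈ Rᶜ, ∑ v ∈ Rᶜ, if G.Adj u v then 1 else 0) + 2 := by
  have htot : (∑ u, ∑ v, if G.Adj u v then 1 else 0) + 2 = 2 * Fintype.card V := by
    rw [← hG.card_edgeFinset, mul_add, ← G.sum_degrees_eq_twice_card_edges]
    congr 1
    refine Finset.sum_congr rfl fun u _ => ?_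
    rw [← SimpleGraph.card_neighborFinset_eq_degree,
      SimpleGraph.neighborFinset_eq_filter, Finset.card_filter]
  have hleaf : ∑ u ∈ R, ∑ v, (if G.Adj u v then 1 else 0) ≤ R.card := by
    rw [Finset.card_eq_sum_ones]
    refine Finset.sum_le_sum fun u hu => ?_
    rw [← Finset.card_filter, Finset.card_le_one]
    intro a ha b hb
    exact hR u hu (by simpa using ha) (by simpa using hb)
  have hsplit : ∀ f : V → ℕ, ∑ v, f v = ∑ v ∈ R, f v + ∑ v ∈ Rᶜ, f v := fun f =>
    (Finset.sum_add_sum_compl R f).symm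
  simp only [hsplit, Finset.sum_add_distrib] at htot hleaf
  have hswap : ∑ u ∈ Rᶜ, ∑ v ∈ R, (if G.Adj u v then 1 else 0)
      = ∑ u ∈ R, ∑ v ∈ Rᶜ, if G.Adj u v then 1 else 0 := by
    rw [Finset.sum_comm]
    simp only [G.adj_comm]
  have hc := Finset.card_add_card_compl R
  omega

theorem dualGraph_adj {V : Type} {M : Matrix V V ℤ} (hsym : ∀ u v, M u v = M v u) {u v : V} :
    (dualGraph M).Adj u v ↔ u ≠ v ∧ 0 < M u v := by
  simp [dualGraph, SimpleGraph.fromRel_adj, hsym v u]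

theorem toQ_sum {V : Type} {ι : Type*} (s : Finset ι) (l : ι → V → ℤ) :
    toQ (∑ i ∈ s, l i) = ∑ i ∈ s, toQ (l i) := by
  ext v
  simp [toQ]

section Pairing

variable {V : Type} [Fintype V] {M : Matrix V V ℤ}

theorem pairQ_eq_toBilin' (M : Matrix V V ℤ) (x y : V → ℚ) :
    pairQ M x y = Matrix.toBilin' (M.map (Int.cast : ℤ → ℚ)) x y := by
  simp [pairQ, Matrix.toBilin'_apply]

theorem pairQ_add_right (M : Matrix V V ℤ) (x y z : V → ℚ) :
    pairQ M x (y + z) = pairQ M x y + pairQ M x z := by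
  simp [pairQ_eq_toBilin']

theorem pairQ_comm (hsym : ∀ u v, M u v = M v u) (x y : V → ℚ) :
    pairQ M x y = pairQ M y x := by
  unfold pairQ
  rw [Finset.sum_comm]
  refine Finset.sum_congr rfl fun u _ => Finset.sum_congr rfl fun v _ => ?_
  rw [hsym]
  ring

theorem pairQ_eq_sum_single [DecidableEq V] (x y : V → ℚ) :
    pairQ M x y = ∑ v, y v * pairQ M x (Pi.single v 1) := by
  conv_lhs => rw [pairQ_eq_toBilin', LinearMap.pi_apply_eq_sum_univ _ y]
  simp only [pairQ_eq_toBilin', smul_eq_mul]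
  refine Finset.sum_congr rfl fun v _ => ?_
  congr 2
  ext w
  simp [Pi.single_apply, eq_comm]

theorem chiQ_zero (M : Matrix V V ℤ) (ZK : V → ℚ) : chiQ M ZK 0 = 0 := by
  simp [chiQ, pairQ]

theorem chiQ_add (hsym : ∀ u v, M u v = M v u) (ZK x y : V → ℚ) :
    chiQ M ZK (x + y) = chiQ M ZK x + chiQ M ZK y - pairQ M x y := by
  have h := pairQ_comm hsym x y
  simp only [chiQ, pairQ_eq_toBilin', map_add, map_sub, LinearMap.add_apply] at h ⊢
  linarith

theorem chiQ_neg_add (hsym : ∀ u v, M u v = M v u) (ZK x y : V → ℚ) :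
    chiQ M ZK (-x + y) = chiQ M ZK (-x) + (chiQ M ZK y + pairQ M x y) := by
  rw [chiQ_add hsym]
  simp only [pairQ_eq_toBilin', map_neg, LinearMap.neg_apply]
  ring

theorem chiQ_sum (hsym : ∀ u v, M u v = M v u) (ZK : V → ℚ) {ι : Type*} (s : Finset ι)
    (x : ι → V → ℚ) (h : ∀ i ∈ s, ∀ j ∈ s, i ≠ j → pairQ M (x i) (x j) = 0) :
    chiQ M ZK (∑ i ∈ s, x i) = ∑ i ∈ s, chiQ M ZK (x i) := by
  induction s using Finset.induction_on with
  | empty => simp [chiQ_zero]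
  | insert a s ha ih =>
    have hz : pairQ M (x a) (∑ i ∈ s, x i) = 0 := by
      have : ∀ i ∈ s, pairQ M (x a) (x i) = 0 := fun i hi =>
        h a (by simp) i (by simp [hi]) (fun e => ha (e ▸ hi))
      simp only [pairQ_eq_toBilin', map_sum] at this ⊢
      exact Finset.sum_eq_zero this
    rw [Finset.sum_insert ha, Finset.sum_insert ha, chiQ_add hsym, hz,
      ih fun i hi j hj => h i (by simp [hi]) j (by simp [hj]), sub_zero]

/-- The reduced cycle `E_S = ∑_{v ∈ S} E_v`. -/
noncomputable def reducedCycle (S : Finset V) : V → ℤ := fun v => if v ∈ S then 1 else 0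

/-- The support of a cycle, as a finset. -/
noncomputable def suppFinset (l : V → ℤ) : Finset V := Finset.univ.filter fun v => l v ≠ 0

theorem mem_suppFinset {l : V → ℤ} {v : V} : v ∈ suppFinset l ↔ l v ≠ 0 := by
  simp [suppFinset]

/-- The Riemann–Roch expression of a reduced cycle is the Euler characteristic of its graph. -/
theorem chiQ_reducedCycle [DecidableEq V] (hsym : ∀ u v, M u v = M v u)
    (hoff : ∀ u v : V, u ≠ v → M u v = 0 ∨ M u v = 1) {ZK : V → ℚ}
    (hZK : ∀ v, pairQ M ZK (Pi.single v 1) = (M v v : ℚ) + 2) (S : Finset V) :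
    2 * chiQ M ZK (toQ (reducedCycle S)) =
      2 * (S.card : ℚ) -
        ((∑ u ∈ S, ∑ v ∈ S, if (dualGraph M).Adj u v then 1 else 0 : ℕ) : ℚ) := by
  have hM : ∀ u v, (M u v : ℚ) =
      (if u = v then (M u u : ℚ) else 0) + if (dualGraph M).Adj u v then 1 else 0 := by
    intro u v
    by_cases huv : u = v
    · simp [huv]
    · rcases hoff u v huv with h | h <;> simp [huv, h, dualGraph_adj hsym]
  have h1 : pairQ M (toQ (reducedCycle S)) ZK = ∑ v ∈ S, ((M v v : ℚ) + 2) := by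
    rw [pairQ_comm hsym, pairQ_eq_sum_single]
    simp [hZK, toQ, reducedCycle]
  have h2 : pairQ M (toQ (reducedCycle S)) (toQ (reducedCycle S)) =
      ∑ u ∈ S, ∑ v ∈ S, (M u v : ℚ) := by
    simp [pairQ, toQ, reducedCycle]
  have h3 : chiQ M ZK (toQ (reducedCycle S)) =
      (pairQ M (toQ (reducedCycle S)) ZK
        - pairQ M (toQ (reducedCycle S)) (toQ (reducedCycle S))) / 2 := by
    simp only [chiQ, pairQ_eq_toBilin', map_sub]
    ring
  rw [h3, h1, h2]
  have h4 : ∑ u ∈ S, ∑ v ∈ S, (M u v : ℚ) =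
      ∑ u ∈ S, (M u u : ℚ) + ∑ u ∈ S, ∑ v ∈ S, if (dualGraph M).Adj u v then 1 else 0 := by
    rw [← Finset.sum_add_distrib]
    refine Finset.sum_congr rfl fun u hu => ?_
    rw [Finset.sum_congr rfl fun v _ => hM u v, Finset.sum_add_distrib, Finset.sum_ite_eq,
      if_pos hu]
  rw [h4, Finset.sum_add_distrib]
  push_cast
  simp only [Finset.sum_const, nsmul_eq_mul]
  ring

theorem one_le_chiQ_reducedCycle [DecidableEq V] (hsym : ∀ u v, M u v = M v u)
    (hoff : ∀ u v : V, u ≠ v → M u v = 0 ∨ M u v = 1) (hG : (dualGraph M).IsAcyclic)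
    {ZK : V → ℚ} (hZK : ∀ v, pairQ M ZK (Pi.single v 1) = (M v v : ℚ) + 2) {S : Finset V}
    (hS : S.Nonempty) : 1 ≤ chiQ M ZK (toQ (reducedCycle S)) := by
  have h1 := chiQ_reducedCycle hsym hoff hZK S
  have h2 : _ ≤ ((2 * S.card : ℕ) : ℚ) := Nat.cast_le.2 (hG.sum_card_adj_add_two_le hS)
  rw [Nat.cast_add, Nat.cast_mul] at h2
  norm_num only [Nat.cast_ofNat] at h2
  linarith

theorem chiQ_reducedCycle_compl_le_one [DecidableEq V] (hsym : ∀ u v, M u v = M v u)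
    (hoff : ∀ u v : V, u ≠ v → M u v = 0 ∨ M u v = 1) (hG : (dualGraph M).IsTree)
    {ZK : V → ℚ} (hZK : ∀ v, pairQ M ZK (Pi.single v 1) = (M v v : ℚ) + 2) {R : Finset V}
    (hR : ∀ v ∈ R, ((dualGraph M).neighborSet v).Subsingleton) :
    chiQ M ZK (toQ (reducedCycle Rᶜ)) ≤ 1 := by
  have h1 := chiQ_reducedCycle hsym hoff hZK Rᶜ
  have h2 : ((2 * Rᶜ.card : ℕ) : ℚ) ≤ _ := Nat.cast_le.2 (hG.two_mul_card_compl_le hR)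
  rw [Nat.cast_add, Nat.cast_mul] at h2
  norm_num only [Nat.cast_ofNat] at h2
  linarith

/-- The difference `χ(−l' + l) − χ(−l')`, see `chiQ_neg_add`. -/
noncomputable def twistedChi (M : Matrix V V ℤ) (ZK l' : V → ℚ) (l : V → ℤ) : ℚ :=
  chiQ M ZK (toQ l) + pairQ M l' (toQ l)

/-- The number of components of the support of `l` (on a forest) minus `twistedChi` of `l`. -/
noncomputable def chiGap (M : Matrix V V ℤ) (ZK l' : V → ℚ) (l : V → ℤ) : ℚ :=
  chiQ M ZK (toQ (reducedCycle (suppFinset l))) - twistedChi M ZK l' l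

theorem twistedChi_zero (M : Matrix V V ℤ) (ZK l' : V → ℚ) : twistedChi M ZK l' 0 = 0 := by
  have : toQ (0 : V → ℤ) = 0 := by ext; simp [toQ]
  simp [twistedChi, this, chiQ_zero, pairQ]

theorem chiGap_zero (M : Matrix V V ℤ) (ZK l' : V → ℚ) : chiGap M ZK l' 0 = 0 := by
  have : toQ (reducedCycle (suppFinset (0 : V → ℤ))) = 0 := by
    ext
    simp [toQ, reducedCycle, suppFinset]
  rw [chiGap, this, chiQ_zero, twistedChi_zero, sub_zero]

theorem pairQ_eq_zero_of_forall {x y : V → ℚ}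
    (h : ∀ u v, x u ≠ 0 → y v ≠ 0 → M u v = 0) : pairQ M x y = 0 := by
  refine Finset.sum_eq_zero fun u _ => Finset.sum_eq_zero fun v _ => ?_
  by_cases hx : x u = 0
  · simp [hx]
  by_cases hy : y v = 0
  · simp [hy]
  simp [h u v hx hy]

theorem reducedCycle_suppFinset_sum {ι : Type*} (s : Finset ι) (l : ι → V → ℤ)
    (h : ∀ i ∈ s, ∀ j ∈ s, i ≠ j → ∀ v, l i v ≠ 0 → l j v = 0) :
    reducedCycle (suppFinset (∑ i ∈ s, l i)) = ∑ i ∈ s, reducedCycle (suppFinset (l i)) := by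
  ext v
  simp only [Finset.sum_apply, reducedCycle, mem_suppFinset]
  by_cases hv : ∃ i ∈ s, l i v ≠ 0
  · obtain ⟨i, hi, hiv⟩ := hv
    have hz : ∀ j ∈ s, j ≠ i → l j v = 0 := fun j hj hji => h i hi j hj hji.symm v hiv
    rw [Finset.sum_eq_single_of_mem i hi hz, Finset.sum_eq_single_of_mem i hi]
    intro j hj hji
    simp [hz j hj hji]
  · push Not at hv
    rw [Finset.sum_eq_zero hv, Finset.sum_eq_zero]
    · simp
    · intro i hi
      simp [hv i hi]

/-- `chiGap` is additive over cycles with disjoint, non-adjacent supports. -/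
theorem chiGap_sum (hsym : ∀ u v, M u v = M v u) (ZK l' : V → ℚ) {ι : Type*} (s : Finset ι)
    (l : ι → V → ℤ)
    (hdisj : ∀ i ∈ s, ∀ j ∈ s, i ≠ j → ∀ v, l i v ≠ 0 → l j v = 0)
    (horth : ∀ i ∈ s, ∀ j ∈ s, i ≠ j → ∀ u v, l i u ≠ 0 → l j v ≠ 0 → M u v = 0) :
    chiGap M ZK l' (∑ i ∈ s, l i) = ∑ i ∈ s, chiGap M ZK l' (l i) := by
  simp only [chiGap, twistedChi, reducedCycle_suppFinset_sum s l hdisj, toQ_sum,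
    Finset.sum_sub_distrib, Finset.sum_add_distrib]
  rw [chiQ_sum hsym, chiQ_sum hsym]
  · simp [pairQ_eq_toBilin']
  · intro i hi j hj hij
    exact pairQ_eq_zero_of_forall fun u v hu hv =>
      horth i hi j hj hij u v (by simpa [toQ] using hu) (by simpa [toQ] using hv)
  · intro i hi j hj hij
    exact pairQ_eq_zero_of_forall fun u v hu hv =>
      horth i hi j hj hij u v (by simpa [toQ, reducedCycle, mem_suppFinset] using hu)
        (by simpa [toQ, reducedCycle, mem_suppFinset] using hv)

/-- Adding a reduced cycle outside the support of `l` and orthogonal to `l'` does not decrease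
`chiGap`. -/
theorem chiGap_le_add_reducedCycle [DecidableEq V] (hsym : ∀ u v, M u v = M v u)
    (hoff : ∀ u v : V, u ≠ v → M u v = 0 ∨ M u v = 1) (ZK : V → ℚ) {l' : V → ℚ} {l : V → ℤ}
    (hl : 0 ≤ l) {U : Finset V} (hU : Disjoint (suppFinset l) U)
    (hl'U : pairQ M l' (toQ (reducedCycle U)) = 0) :
    chiGap M ZK l' l ≤ chiQ M ZK (toQ (reducedCycle (suppFinset l ∪ U))) -
      twistedChi M ZK l' (l + reducedCycle U) := by
  have h1 : toQ (reducedCycle (suppFinset l ∪ U)) =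
      toQ (reducedCycle (suppFinset l)) + toQ (reducedCycle U) := by
    ext v
    have : v ∈ suppFinset l → v ∉ U := fun h => Finset.disjoint_left.1 hU h
    by_cases h : v ∈ suppFinset l <;> simp_all [toQ, reducedCycle]
  have h2 : toQ (l + reducedCycle U) = toQ l + toQ (reducedCycle U) := by
    ext v
    simp [toQ]
  have h3 : pairQ M (toQ (reducedCycle (suppFinset l))) (toQ (reducedCycle U)) ≤
      pairQ M (toQ l) (toQ (reducedCycle U)) := by
    refine Finset.sum_le_sum fun u _ => Finset.sum_le_sum fun v _ => ?_
    by_cases hv : v ∈ U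
    · by_cases hu : l u = 0
      · simp [toQ, reducedCycle, mem_suppFinset, hu]
      · have huv : u ≠ v := fun e =>
          Finset.disjoint_left.1 hU (mem_suppFinset.2 hu) (e ▸ hv)
        have hlu : (1 : ℚ) ≤ l u := by
          have := hl u
          simp only [Pi.zero_apply] at this
          exact_mod_cast (by omega : 1 ≤ l u)
        rcases hoff u v huv with h | h <;>
          simp [toQ, reducedCycle, mem_suppFinset, hu, hv, h, hlu]
    · simp [toQ, reducedCycle, hv]
  simp only [chiGap, twistedChi, h1, h2, chiQ_add hsym, pairQ_add_right, hl'U]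
  linarith

end Pairing

theorem compCycle_nonneg {V : Type} {M : Matrix V V ℤ} {W : V → ℤ} (hW : 0 ≤ W)
    (c : (inducedOnSupp M W).ConnectedComponent) : 0 ≤ compCycle M W c := by
  intro v
  unfold compCycle
  split_ifs
  exacts [hW v, le_rfl, le_rfl]

theorem compCycle_le {V : Type} {M : Matrix V V ℤ} {W : V → ℤ} (hW : 0 ≤ W)
    (c : (inducedOnSupp M W).ConnectedComponent) : compCycle M W c ≤ W := by
  intro v
  unfold compCycle
  split_ifs
  exacts [le_rfl, hW v, hW v]

theorem exists_connectedComponentMk_eq_of_compCycle_ne_zero {V : Type} {M : Matrix V V ℤ}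
    {W : V → ℤ} {c : (inducedOnSupp M W).ConnectedComponent} {v : V}
    (h : compCycle M W c v ≠ 0) :
    ∃ hv : W v ≠ 0, (inducedOnSupp M W).connectedComponentMk ⟨v, hv⟩ = c := by
  unfold compCycle at h
  split_ifs at h with h1 h2
  exacts [⟨h1, h2⟩, (h rfl).elim, (h rfl).elim]

theorem compCycle_eq_zero_of_ne {V : Type} {M : Matrix V V ℤ} {W : V → ℤ}
    {c d : (inducedOnSupp M W).ConnectedComponent} (hcd : c ≠ d) {v : V}
    (h : compCycle M W c v ≠ 0) : compCycle M W d v = 0 := by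
  by_contra h'
  obtain ⟨hv, rfl⟩ := exists_connectedComponentMk_eq_of_compCycle_ne_zero h
  obtain ⟨_, rfl⟩ := exists_connectedComponentMk_eq_of_compCycle_ne_zero h'
  exact hcd rfl

theorem apply_eq_zero_of_compCycle_ne_zero {V : Type} {M : Matrix V V ℤ} {W : V → ℤ}
    (hsym : ∀ u v, M u v = M v u) (hoff : ∀ u v : V, u ≠ v → M u v = 0 ∨ M u v = 1)
    {c d : (inducedOnSupp M W).ConnectedComponent} (hcd : c ≠ d) {u v : V}
    (hu : compCycle M W c u ≠ 0) (hv : compCycle M W d v ≠ 0) : M u v = 0 := by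
  have huv : u ≠ v := fun e => hv (e ▸ compCycle_eq_zero_of_ne hcd hu)
  refine (hoff u v huv).resolve_right fun h1 => hcd ?_
  obtain ⟨hu', rfl⟩ := exists_connectedComponentMk_eq_of_compCycle_ne_zero hu
  obtain ⟨hv', rfl⟩ := exists_connectedComponentMk_eq_of_compCycle_ne_zero hv
  refine SimpleGraph.ConnectedComponent.sound (SimpleGraph.Adj.reachable ?_)
  exact (dualGraph_adj hsym).2 ⟨huv, h1 ▸ one_pos⟩

/-- A cycle whose support is everything has a single component, if the dual graph is connected. -/
theorem sumComp_eq_self {V : Type} [Fintype V] {M : Matrix V V ℤ}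
    (hG : (dualGraph M).Connected) {Z : V → ℤ} (hZ : ∀ v, Z v ≠ 0) (F : (V → ℤ) → ℚ) :
    sumComp M F Z = F Z := by
  have hsupp : supp Z = Set.univ := Set.eq_univ_of_forall hZ
  have hconn : (inducedOnSupp M Z).Connected := by
    unfold inducedOnSupp
    rw [hsupp]
    exact (SimpleGraph.induceUnivIso _).connected_iff.2 hG
  have := hconn.preconnected.subsingleton_connectedComponent
  have hcomp : ∀ c, compCycle M Z c = Z := fun c => by
    ext v
    unfold compCycle
    rw [dif_pos (hZ v), if_pos (Subsingleton.elim _ _)]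
  obtain ⟨v⟩ := hconn.nonempty
  have := uniqueOfSubsingleton ((inducedOnSupp M Z).connectedComponentMk v)
  rw [sumComp, finsum_unique, hcomp]

/-- Adding to `0 ≤ l ≤ Z` all vertices outside its support that are not end vertices gives a cycle
`x ≤ Z` of connected support, and `1 - twistedChi x` is at least the `chiGap` of `l`. -/
theorem exists_chiGap_le_one_sub_twistedChi {V : Type} [Fintype V] [DecidableEq V]
    {M : Matrix V V ℤ} {ZK l' : V → ℚ}
    (hsym : ∀ u v, M u v = M v u)
    (hoff : ∀ u v : V, u ≠ v → M u v = 0 ∨ M u v = 1)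
    (htree : (dualGraph M).IsTree)
    (hZK : ∀ v, pairQ M ZK (Pi.single v 1) = (M v v : ℚ) + 2)
    (hl' : ∀ v, 0 ≤ pairQ M l' (Pi.single v 1))
    (hend : ∀ v : V, 0 < pairQ M l' (Pi.single v 1) →
      ((dualGraph M).neighborSet v).Subsingleton)
    {Z : V → ℤ} (hZ : ∀ v, 1 ≤ Z v) {l : V → ℤ} (hl : 0 ≤ l) (hlZ : l ≤ Z) :
    ∃ x : V → ℤ, 0 ≤ x ∧ x ≤ Z ∧ chiGap M ZK l' l ≤ 1 - twistedChi M ZK l' x := by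
  set R : Finset V := Finset.univ.filter fun v =>
    v ∉ suppFinset l ∧ ((dualGraph M).neighborSet v).Subsingleton with hRdef
  set U : Finset V := Finset.univ.filter fun v =>
    v ∉ suppFinset l ∧ ¬ ((dualGraph M).neighborSet v).Subsingleton with hUdef
  have hcompl : suppFinset l ∪ U = Rᶜ := by
    ext v
    simp only [hRdef, hUdef, Finset.mem_union, Finset.mem_compl, Finset.mem_filter,
      Finset.mem_univ, true_and]
    tauto
  have hU : Disjoint (suppFinset l) U :=
    Finset.disjoint_right.2 fun v hv => (Finset.mem_filter.1 hv).2.1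
  have hl'U : pairQ M l' (toQ (reducedCycle U)) = 0 := by
    rw [pairQ_eq_sum_single]
    refine Finset.sum_eq_zero fun v _ => ?_
    by_cases hv : v ∈ U
    · have : ¬ 0 < pairQ M l' (Pi.single v 1) := fun h =>
        (Finset.mem_filter.1 hv).2.2 (hend v h)
      rw [le_antisymm (not_lt.1 this) (hl' v), mul_zero]
    · simp [toQ, reducedCycle, hv]
  have h1 := chiGap_le_add_reducedCycle hsym hoff ZK hl hU hl'U
  rw [hcompl] at h1
  have h2 := chiQ_reducedCycle_compl_le_one hsym hoff htree hZK (R := R)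
    fun v hv => (Finset.mem_filter.1 hv).2.2
  refine ⟨l + reducedCycle U, fun v => ?_, fun v => ?_, by linarith⟩
  · have := hl v
    simp only [Pi.zero_apply, Pi.add_apply, reducedCycle] at this ⊢
    split_ifs <;> omega
  · by_cases hv : v ∈ U
    · have hlv : l v = 0 := by
        by_contra h
        exact Finset.disjoint_left.1 hU (mem_suppFinset.2 h) hv
      simpa [reducedCycle, hv, hlv] using hZ v
    · simpa [reducedCycle, hv] using hlZ v

/-- Example 6.5.  If every vertex of the `E^*`-support
`I = {v : (l',E_v) > 0}` is an end vertex of the tree `G` (degree `≤ 1`,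
i.e. its neighbour set is subsingleton), then `t(Z,l') = T(Z,l')`. -/
theorem stmt_10
    (V : Type) [Fintype V] [DecidableEq V] [Nonempty V]
    (M : Matrix V V ℤ)
    (hsym : ∀ u v, M u v = M v u)
    (hneg : ∀ x : V → ℚ, x ≠ 0 → pairQ M x x < 0)
    (hoff : ∀ u v : V, u ≠ v → M u v = 0 ∨ M u v = 1)
    (htree : (dualGraph M).IsTree)
    (ZK : V → ℚ)
    (hZK : ∀ v, pairQ M ZK (Pi.single v 1) = (M v v : ℚ) + 2)
    (l' : V → ℚ)
    (hl' : ∀ v, ∃ n : ℕ, pairQ M l' (Pi.single v 1) = n)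
    (Z : V → ℤ) (hZ : ∀ v, 1 ≤ Z v)
    -- every vertex of the `E^*`-support of `l'` is an end vertex of `G`
    (hend : ∀ v : V, 0 < pairQ M l' (Pi.single v 1) →
      ((dualGraph M).neighborSet v).Subsingleton)
    -- `D` : the dominance defect
    (D : (V → ℤ) → ℚ)
    (hD0 : ∀ W : V → ℤ,
      (∀ l : V → ℤ, 0 < l → l ≤ W → chiQ M ZK (-l') < chiQ M ZK (-l' + toQ l)) →
      D W = 0)
    (hD1 : ∀ W : V → ℤ,
      (∃ l : V → ℤ, 0 < l ∧ l ≤ W ∧ chiQ M ZK (-l' + toQ l) ≤ chiQ M ZK (-l')) →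
      D W = 1)
    -- `μ W = min_{0 ≤ l ≤ W} χ(−l' + l)`
    (μ : (V → ℤ) → ℚ)
    (hμ : ∀ W : V → ℤ, 0 ≤ W →
      IsLeast {q : ℚ | ∃ l : V → ℤ, 0 ≤ l ∧ l ≤ W ∧
        q = chiQ M ZK (-l' + toQ l)} (μ W))
    -- `t = t(Z,l')`
    (t : ℚ)
    (ht : IsGreatest {q : ℚ | ∃ W : V → ℤ, 0 < W ∧ W ≤ Z ∧
      q = sumComp M (fun W' => chiQ M ZK (-l') - μ W' + D W') W} t) :
    t = chiQ M ZK (-l') - μ Z + D Z := by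
  have hchi : ∀ l, chiQ M ZK (-l' + toQ l) = chiQ M ZK (-l') + twistedChi M ZK l' l := fun l =>
    chiQ_neg_add hsym ZK l' (toQ l)
  have hμ_le : ∀ W l : V → ℤ, 0 ≤ l → l ≤ W → μ W ≤ chiQ M ZK (-l') + twistedChi M ZK l' l :=
    fun W l hl hlW => (hμ W (hl.trans hlW)).2 ⟨l, hl, hlW, (hchi l).symm⟩
  have hZ0 : 0 ≤ Z := fun v => zero_le_one.trans (hZ v)
  refine le_antisymm ?_ (ht.2 ⟨Z, ?_, le_rfl, ?_⟩)
  · obtain ⟨⟨W, hW, hWZ, rfl⟩, -⟩ := ht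
    have : Fintype (inducedOnSupp M W).ConnectedComponent := Fintype.ofFinite _
    rw [sumComp, finsum_eq_sum_of_fintype]
    by_cases hex : ∃ l : V → ℤ, 0 < l ∧ l ≤ Z ∧ chiQ M ZK (-l' + toQ l) ≤ chiQ M ZK (-l')
    · have hgap : ∀ W' : V → ℤ, 0 ≤ W' →
          ∃ l : V → ℤ, 0 ≤ l ∧ l ≤ W' ∧ chiQ M ZK (-l') - μ W' + D W' ≤ chiGap M ZK l' l := by
        intro W' hW'
        obtain ⟨m, hm, hmW, hmμ⟩ := (hμ W' hW').1
        rw [hchi] at hmμ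
        have hpos : ∀ l : V → ℤ, 0 < l → 1 - twistedChi M ZK l' l ≤ chiGap M ZK l' l := by
          intro l hl
          obtain ⟨v, hv⟩ := Function.ne_iff.1 hl.ne'
          exact sub_le_sub_right (one_le_chiQ_reducedCycle hsym hoff htree.isAcyclic hZK
            ⟨v, mem_suppFinset.2 hv⟩) _
        by_cases hex' : ∃ l : V → ℤ, 0 < l ∧ l ≤ W' ∧
            chiQ M ZK (-l' + toQ l) ≤ chiQ M ZK (-l')
        · rw [hD1 W' hex', hmμ]
          obtain ⟨l, hl, hlW, hlχ⟩ := hex'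
          rw [hchi] at hlχ
          rcases hm.eq_or_lt with rfl | hm0
          · refine ⟨l, hl.le, hlW, le_trans ?_ (hpos l hl)⟩
            rw [twistedChi_zero]
            linarith
          · exact ⟨m, hm, hmW, le_trans (by linarith) (hpos m hm0)⟩
        · push Not at hex'
          refine ⟨0, le_rfl, hW', ?_⟩
          rw [hD0 W' hex', chiGap_zero, hmμ]
          rcases hm.eq_or_lt with rfl | hm0
          · simp [twistedChi_zero]
          · have := hex' m hm0 hmW
            rw [hchi] at this
            linarith
      choose l hl0 hlW hlgap using fun c => hgap _ (compCycle_nonneg (M := M) hW.le c)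
      have hne : ∀ c v, l c v ≠ 0 → compCycle M W c v ≠ 0 := fun c v h h' =>
        h (le_antisymm (h' ▸ hlW c v) (hl0 c v))
      have hdisj : ∀ c d, c ≠ d → ∀ v, l c v ≠ 0 → l d v = 0 := fun c d hcd v hv => by
        by_contra h
        exact hne d v h (compCycle_eq_zero_of_ne hcd (hne c v hv))
      have hsum0 : 0 ≤ ∑ c, l c := Finset.sum_nonneg fun c _ => hl0 c
      have hsumZ : ∑ c, l c ≤ Z := by
        intro v
        rw [Finset.sum_apply]
        by_cases hv : ∃ c, l c v ≠ 0
        · obtain ⟨c, hc⟩ := hv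
          rw [Finset.sum_eq_single_of_mem c (Finset.mem_univ c)
            fun d _ hd => hdisj c d hd.symm v hc]
          exact ((hlW c).trans ((compCycle_le hW.le c).trans hWZ)) v
        · push Not at hv
          rw [Finset.sum_eq_zero fun c _ => hv c]
          exact hZ0 v
      have hl'0 : ∀ v, 0 ≤ pairQ M l' (Pi.single v 1) := fun v => by
        obtain ⟨n, hn⟩ := hl' v
        exact hn ▸ n.cast_nonneg
      obtain ⟨x, hx0, hxZ, hx⟩ :=
        exists_chiGap_le_one_sub_twistedChi hsym hoff htree hZK hl'0 hend hZ hsum0 hsumZ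
      rw [chiGap_sum hsym ZK l' _ l (fun c _ d _ => hdisj c d) fun c _ d _ hcd u v hu hv =>
        apply_eq_zero_of_compCycle_ne_zero hsym hoff hcd (hne c u hu) (hne d v hv)] at hx
      refine (Finset.sum_le_sum fun c _ => hlgap c).trans (hx.trans ?_)
      rw [hD1 Z hex]
      linarith [hμ_le Z x hx0 hxZ]
    · push Not at hex
      have hzero : ∀ W' : V → ℤ, 0 ≤ W' → W' ≤ Z → chiQ M ZK (-l') - μ W' + D W' = 0 := by
        intro W' hW' hW'Z
        have hpos : ∀ l : V → ℤ, 0 < l → l ≤ W' → chiQ M ZK (-l') < chiQ M ZK (-l' + toQ l) :=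
          fun l hl hlW => hex l hl (hlW.trans hW'Z)
        have hle := hμ_le W' 0 le_rfl hW'
        obtain ⟨m, hm, hmW, hmμ⟩ := (hμ W' hW').1
        rw [twistedChi_zero] at hle
        rw [hD0 W' hpos]
        rcases hm.eq_or_lt with rfl | hm0
        · rw [hmμ, hchi, twistedChi_zero]
          ring
        · linarith [hpos m hm0 hmW]
      rw [Finset.sum_eq_zero fun c _ => hzero _ (compCycle_nonneg hW.le c)
        ((compCycle_le hW.le c).trans hWZ), hzero Z hZ0 le_rfl]
  · obtain ⟨v⟩ := ‹Nonempty V›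
    exact lt_of_le_of_ne hZ0 fun h => by simpa [← h] using hZ v
  · rw [sumComp_eq_self htree.connected fun v => (zero_lt_one.trans_le (hZ v)).ne']
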